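/- Let R be a commutative ring in which 2 is invertible, G a group, T : G → R a 2-dimensional pseudo-representation, and σ* ∈ G an element with (σ*)² = 1 and T(σ*) = 0. Suppose x(σ,τ) = 0 for all σ, τ ∈ G. Then a and d take values in the units Rˣ and are group homomorphisms G → Rˣ; the map ρ : G → GL₂(R) sending σ to the diagonal matrix diag(a(σ), d(σ)) is a group homomorphism with tr(ρ(σ)) = T(σ); and det(ρ(σ)) = a(σ)d(σ) = (1/2)(T(σ)² − T(σ²)) for all σ ∈ G. -/

import Mathlib

section PseudoRep

variable {R : Type*} [CommRing R] {G : Type*} [Group G]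

/-- `a(σ) = (1/2)(T(σ*σ) + T(σ))`. -/
noncomputable def aPR (T : G → R) (σs σ : G) : R :=
  Ring.inverse 2 * (T (σs * σ) + T σ)

/-- `d(σ) = (1/2)(−T(σ*σ) + T(σ)) = T(σ) − a(σ)`. -/
noncomputable def dPR (T : G → R) (σs σ : G) : R :=
  T σ - aPR T σs σ

/-- `x(σ,τ) = a(στ) − a(σ)a(τ)`. -/
noncomputable def xPR (T : G → R) (σs σ τ : G) : R :=
  aPR T σs (σ * τ) - aPR T σs σ * aPR T σs τ

lemma two_mul_aPR (T : G → R) (h2 : IsUnit (2 : R)) (σs σ : G) :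
    2 * aPR T σs σ = T (σs * σ) + T σ := by
  rw [aPR, ← mul_assoc, Ring.mul_inverse_cancel _ h2, one_mul]

lemma aPR_add_dPR (T : G → R) (σs σ : G) : aPR T σs σ + dPR T σs σ = T σ := by
  rw [dPR, add_sub_cancel]

/-- If `a` is multiplicative, then so is `d`. -/
lemma dPR_mul (T : G → R) (h2 : IsUnit (2 : R))
    (hTcomm : ∀ σ τ : G, T (σ * τ) = T (τ * σ))
    (hTrel : ∀ γ δ η : G,
      T (γ * δ * η) + T (γ * η * δ) - T (γ * η) * T δ - T (η * δ) * T γ -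
        T (δ * γ) * T η + T γ * T δ * T η = 0)
    (σs : G) (hTσs : T σs = 0)
    (ha : ∀ σ τ : G, aPR T σs (σ * τ) = aPR T σs σ * aPR T σs τ) (σ τ : G) :
    dPR T σs (σ * τ) = dPR T σs σ * dPR T σs τ := by
  have hrel := hTrel σs σ τ
  rw [hTσs, hTcomm σ σs, mul_assoc, mul_assoc] at hrel
  have hστ := two_mul_aPR T h2 σs (σ * τ)
  have hτσ := two_mul_aPR T h2 σs (τ * σ)
  rw [ha] at hστ hτσ
  rw [hTcomm τ σ] at hτσ
  have hσ := two_mul_aPR T h2 σs σ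
  have hτ := two_mul_aPR T h2 σs τ
  apply h2.mul_left_cancel
  simp only [dPR, ha]
  linear_combination -hrel - hστ - hτσ + T τ * hσ + T σ * hτ

/-- The homomorphism to `GL₂` given by the diagonal matrix of two characters. -/
def diagonalGL (χ ψ : G →* R) : G →* Matrix.GeneralLinearGroup (Fin 2) R :=
  MonoidHom.toHomUnits
    { toFun := fun σ => Matrix.diagonal ![χ σ, ψ σ]
      map_one' := by
        ext i j
        fin_cases i <;> fin_cases j <;> simp
      map_mul' := fun σ τ => by
        ext i j
        fin_cases i <;> fin_cases j <;> simp }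

/-- (Reducible case.)  If all `x(σ,τ) = 0`, then `a` and `d` take unit values and
are multiplicative, the diagonal map `σ ↦ diag (a σ, d σ)` is a group homomorphism `G → GL₂(R)`
with trace `T`, and its determinant is `a(σ)d(σ) = (1/2)(T(σ)² − T(σ²))`. -/
theorem reducible_pseudoRep (T : G → R) (h2 : IsUnit (2 : R))
    (hT1 : T 1 = 2)
    (hTcomm : ∀ σ τ : G, T (σ * τ) = T (τ * σ))
    (hTrel : ∀ γ δ η : G,
      T (γ * δ * η) + T (γ * η * δ) - T (γ * η) * T δ - T (η * δ) * T γ -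
        T (δ * γ) * T η + T γ * T δ * T η = 0)
    (σs : G) (hσs : σs ^ 2 = 1) (hTσs : T σs = 0)
    (hx : ∀ σ τ : G, xPR T σs σ τ = 0) :
    (∀ σ : G, IsUnit (aPR T σs σ) ∧ IsUnit (dPR T σs σ)) ∧
    (aPR T σs 1 = 1 ∧ ∀ σ τ : G, aPR T σs (σ * τ) = aPR T σs σ * aPR T σs τ) ∧
    (dPR T σs 1 = 1 ∧ ∀ σ τ : G, dPR T σs (σ * τ) = dPR T σs σ * dPR T σs τ) ∧
    (∃ ρ : G →* Matrix.GeneralLinearGroup (Fin 2) R,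
      ∀ σ : G, (ρ σ : Matrix (Fin 2) (Fin 2) R) =
        Matrix.diagonal ![aPR T σs σ, dPR T σs σ]) ∧
    (∀ σ : G, Matrix.trace (Matrix.diagonal ![aPR T σs σ, dPR T σs σ]) = T σ) ∧
    (∀ σ : G,
      Matrix.det (Matrix.diagonal ![aPR T σs σ, dPR T σs σ]) = aPR T σs σ * dPR T σs σ ∧
      aPR T σs σ * dPR T σs σ = Ring.inverse 2 * (T σ ^ 2 - T (σ ^ 2))) := by
  have ha1 : aPR T σs 1 = 1 := by
    rw [aPR, mul_one, hTσs, hT1, zero_add, Ring.inverse_mul_cancel _ h2]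
  have ha (σ τ : G) : aPR T σs (σ * τ) = aPR T σs σ * aPR T σs τ := sub_eq_zero.mp (hx σ τ)
  have hd1 : dPR T σs 1 = 1 := by
    rw [dPR, hT1, ha1]
    norm_num
  have hd := dPR_mul T h2 hTcomm hTrel σs hTσs ha
  let χ : G →* R := { toFun := aPR T σs, map_one' := ha1, map_mul' := ha }
  let ψ : G →* R := { toFun := dPR T σs, map_one' := hd1, map_mul' := hd }
  refine ⟨fun σ => ⟨(Group.isUnit σ).map χ, (Group.isUnit σ).map ψ⟩, ⟨ha1, ha⟩, ⟨hd1, hd⟩,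
    ⟨diagonalGL χ ψ, fun _ => rfl⟩, fun σ => ?_, fun σ => ⟨?_, ?_⟩⟩
  · simp [Matrix.trace_diagonal, aPR_add_dPR]
  · simp [Matrix.det_diagonal]
  · apply h2.mul_left_cancel
    rw [Ring.mul_inverse_cancel_left _ _ h2, ← aPR_add_dPR T σs σ,
      ← aPR_add_dPR T σs (σ ^ 2), pow_two σ, ha, hd]
    ring

end PseudoRep
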